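/- Let D = (V, E) be a finite directed graph and S ⊆ V a target set, and let D' be the associated capacity network with lower and upper bounds: its vertex set is {vⁱⁿ, vᵒᵘᵗ : v ∈ V} ∪ {v_s, v_t}; its edges and bounds [l, c] are (vᵢᵒᵘᵗ, vⱼⁱⁿ) with [0,1] for each (vᵢ, vⱼ) ∈ E, (vⁱⁿ, vᵒᵘᵗ) with [1,1] for v ∈ S and [0,1] for v ∉ S, (v_s, vⁱⁿ) with [0,1] and (vᵒᵘᵗ, v_t) with [0,1] for each v ∈ V, and (v_t, v_s) with lower bound 0 and no upper bound. Then a feasible circulation of D' always exists: there is a function f assigning to each edge a nonnegative real number such that l(e) ≤ f(e) ≤ c(e) on every edge e and, at every vertex, the total flow entering equals the total flow leaving. -/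

import Mathlib

/-- Vertices of the associated capacity network `D'`: for each original vertex `v` an
in-copy `vⁱⁿ` and an out-copy `vᵒᵘᵗ`, plus a source `v_s` (`src`) and a sink `v_t`
(`snk`). -/
inductive Node (V : Type*) where
  | inn : V → Node V
  | out : V → Node V
  | src : Node V
  | snk : Node V
deriving DecidableEq, Fintype

/-- The edges of the capacity network `D'` associated to the directed graph `(V, E)`
and target set `S`: `(vᵢᵒᵘᵗ, vⱼⁱⁿ)` for each original edge `(vᵢ, vⱼ) ∈ E`, the split
edge `(vⁱⁿ, vᵒᵘᵗ)` for each `v ∈ V`, the edges `(v_s, vⁱⁿ)` and `(vᵒᵘᵗ, v_t)` for each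
`v ∈ V`, and the return edge `(v_t, v_s)`. -/
def IsEdge {V : Type*} (E : Finset (V × V)) : Node V → Node V → Prop
  | .out v, .inn w => (v, w) ∈ E
  | .inn v, .out w => v = w
  | .src, .inn _ => True
  | .out _, .snk => True
  | .snk, .src => True
  | _, _ => False

/-- A feasible circulation of the capacity network `D'`: a nonnegative flow supported on
the edges of `D'`, respecting the lower bound `1` on split edges `(vⁱⁿ, vᵒᵘᵗ)` of target
vertices `v ∈ S`, the upper bound `1` on every edge except the unbounded return edge
`(v_t, v_s)`, and flow conservation at every vertex. -/
structure IsFeasibleCirculation {V : Type*} [Fintype V] [DecidableEq V]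
    (E : Finset (V × V)) (S : Finset V) (f : Node V → Node V → ℝ) : Prop where
  support : ∀ x y : Node V, ¬ IsEdge E x y → f x y = 0
  nonneg : ∀ x y : Node V, 0 ≤ f x y
  cap_edge : ∀ v w : V, (v, w) ∈ E → f (.out v) (.inn w) ≤ 1
  cap_split : ∀ v : V, f (.inn v) (.out v) ≤ 1
  lb_split : ∀ v ∈ S, 1 ≤ f (.inn v) (.out v)
  cap_src : ∀ v : V, f .src (.inn v) ≤ 1
  cap_snk : ∀ v : V, f (.out v) .snk ≤ 1
  conserve : ∀ x : Node V, ∑ y : Node V, f y x = ∑ y : Node V, f x y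

/-- A circulation is integral if all its flow values are natural numbers. -/
def IsIntegralFlow {V : Type*} (f : Node V → Node V → ℝ) : Prop :=
  ∀ x y : Node V, ∃ n : ℕ, f x y = n

/-- The vertices of the network as a disjoint union of two copies of `V` and two points. -/
def nodeEquivSum (V : Type*) : Node V ≃ (V ⊕ V) ⊕ (Unit ⊕ Unit) where
  toFun
    | .inn v => .inl (.inl v)
    | .out v => .inl (.inr v)
    | .src => .inr (.inl ())
    | .snk => .inr (.inr ())
  invFun
    | .inl (.inl v) => .inn v
    | .inl (.inr v) => .out v
    | .inr (.inl _) => .src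
    | .inr (.inr _) => .snk
  left_inv x := by cases x <;> rfl
  right_inv x := by rcases x with (_ | _) | (_ | _) <;> rfl

theorem sum_node {V M : Type*} [Fintype V] [AddCommMonoid M] (g : Node V → M) :
    ∑ x, g x = (∑ v, g (.inn v) + ∑ v, g (.out v)) + (g .src + g .snk) := by
  rw [← (nodeEquivSum V).symm.sum_comp g]
  simp [Fintype.sum_sum_type, nodeEquivSum]

/-- The circulation sending one unit along each path `v_s → vⁱⁿ → vᵒᵘᵗ → v_t`, and all of it
back along the return edge. -/
def unitPathFlow (V : Type*) [Fintype V] [DecidableEq V] : Node V → Node V → ℝ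
  | .inn v, .out w => if v = w then 1 else 0
  | .src, .inn _ => 1
  | .out _, .snk => 1
  | .snk, .src => Fintype.card V
  | _, _ => 0

/-- A feasible circulation of the associated capacity network `D'`
always exists. -/
theorem feasible_circulation_exists
    {V : Type*} [Fintype V] [DecidableEq V] (E : Finset (V × V)) (S : Finset V) :
    ∃ f : Node V → Node V → ℝ, IsFeasibleCirculation E S f := by
  refine ⟨unitPathFlow V, ?_, ?_, ?_, ?_, ?_, ?_, ?_, ?_⟩
  · intro x y h
    cases x <;> cases y <;> simp_all [IsEdge, unitPathFlow]
  · intro x y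
    cases x <;> cases y <;> simp only [unitPathFlow] <;> (try split_ifs) <;> positivity
  · simp [unitPathFlow]
  · simp [unitPathFlow]
  · simp [unitPathFlow]
  · simp [unitPathFlow]
  · simp [unitPathFlow]
  · intro x
    cases x <;> simp [sum_node, unitPathFlow]
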